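/- There exists a constant C > 0 such that for all k, n ∈ ℕ with k, n ≥ 2, the simple random walk on ℤ² started at the origin satisfies E[ M(k,n) ] ≤ C · max{ 1, (n/k²) · (log k)² / (log n)² }, where M(k,n) is the number of squares Q(z,k), z ∈ Λ(k), that intersect the inner boundary ∂R(n) of the range. -/

import Mathlib

open Real

/-- A single step of the simple random walk on `ℤ^d`: the pair `(i, b)` encodes a move by
`+eᵢ` (if `b = true`) or `-eᵢ` (if `b = false`).  The uniform distribution on `Fin d × Bool`
corresponds to the uniform distribution on the `2d` unit vectors. -/
def step {d : ℕ} (a : Fin d × Bool) : Fin d → ℤ :=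
  fun j => if j = a.1 then (if a.2 then 1 else -1) else 0

/-- The position `S(k)` of the walk started at `z` after `k` steps, driven by the
sequence of i.i.d. uniform steps `ω : Fin n → Fin d × Bool` (meaningful for `k ≤ n`). -/
def walk {d n : ℕ} (z : Fin d → ℤ) (ω : Fin n → Fin d × Bool) (k : ℕ) : Fin d → ℤ :=
  z + ∑ i ∈ Finset.univ.filter (fun i : Fin n => (i : ℕ) < k), step (ω i)

/-- Probability of an event for the `n`-step simple random walk on `ℤ^d`:
the driving step sequences are uniform among the `(2d)^n` possibilities. -/
noncomputable def prW (d n : ℕ) (E : Set (Fin n → Fin d × Bool)) : ℝ :=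
  E.ncard / (2 * d) ^ n

/-- Expectation of a random variable of the `n`-step simple random walk on `ℤ^d`. -/
noncomputable def exW (d n : ℕ) (f : (Fin n → Fin d × Bool) → ℝ) : ℝ :=
  (∑ ω : Fin n → Fin d × Bool, f ω) / (2 * d) ^ n

/-- Shannon entropy (base 2) of a random variable `X` of the `n`-step walk:
`H(X) = ∑ₐ -P[X = a] · log₂ P[X = a]`. -/
noncomputable def entW {α : Type*} (d n : ℕ) (X : (Fin n → Fin d × Bool) → α) : ℝ :=
  ∑' a : α, -(prW d n {ω | X ω = a} * logb 2 (prW d n {ω | X ω = a}))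

/-- The range `R(n) = {S(0), …, S(n)}` of the `n`-step walk started at `z`. -/
def rangeW {d n : ℕ} (z : Fin d → ℤ) (ω : Fin n → Fin d × Bool) : Finset (Fin d → ℤ) :=
  (Finset.range (n + 1)).image (walk z ω)

/-- The inner boundary `∂A` of a finite set `A ⊆ ℤ^d`: the points of `A` adjacent
(at graph distance 1, i.e. reachable by a single step) to some vertex of the complement. -/
def innerBdry {d : ℕ} (A : Finset (Fin d → ℤ)) : Finset (Fin d → ℤ) :=
  A.filter fun x => ∃ a : Fin d × Bool, x + step a ∉ A

/-- The Euclidean (`L²`) norm on `ℤ^d`. -/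
noncomputable def eNorm {d : ℕ} (x : Fin d → ℤ) : ℝ :=
  Real.sqrt (∑ i, ((x i : ℝ)) ^ 2)

/-- The square `Q(z,k) = {z + (j,j′) : −k ≤ j, j′ ≤ k}` of side length `2k+1` centered at `z`. -/
def square (z : Fin 2 → ℤ) (k : ℕ) : Set (Fin 2 → ℤ) :=
  {w | ∀ i, |w i - z i| ≤ (k : ℤ)}

/-- The lattice `Λ(k) = (2k+1)·ℤ²` of centers of the squares tiling `ℤ²`. -/
def lat (k : ℕ) : Set (Fin 2 → ℤ) :=
  {z | ∃ w : Fin 2 → ℤ, z = (2 * (k : ℤ) + 1) • w}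

/-- `M(k,n)`: the number of squares `Q(z,k)`, `z ∈ Λ(k)`, meeting the inner boundary
`∂R(n)` of the range of the `n`-step walk started at the origin. -/
noncomputable def Mnum (k n : ℕ) (ω : Fin n → Fin 2 × Bool) : ℕ :=
  {z | z ∈ lat k ∧ ∃ x ∈ innerBdry (rangeW (0 : Fin 2 → ℤ) ω), x ∈ square z k}.ncard

namespace BoundarySquares

/-! ### One-dimensional walk -/

/-- The probability that the simple random walk on `ℤ` started at `0` is at `u` after `i` steps. -/
noncomputable def lineKernel : ℕ → ℤ → ℝ
  | 0, u => if u = 0 then 1 else 0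
  | i + 1, u => (lineKernel i (u - 1) + lineKernel i (u + 1)) / 2

lemma lineKernel_nonneg (i : ℕ) (u : ℤ) : 0 ≤ lineKernel i u := by
  induction i generalizing u with
  | zero => unfold lineKernel; split_ifs <;> norm_num
  | succ i ih => unfold lineKernel; have := ih (u - 1); have := ih (u + 1); positivity

lemma lineKernel_neg (i : ℕ) (u : ℤ) : lineKernel i (-u) = lineKernel i u := by
  induction i generalizing u with
  | zero => simp [lineKernel]
  | succ i ih =>
    simp only [lineKernel]
    rw [← ih (u - 1), ← ih (u + 1), add_comm]
    congr 3 <;> ring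

lemma lineKernel_eq_zero_of_odd (i : ℕ) (u : ℤ) (h : Odd (i + u)) : lineKernel i u = 0 := by
  induction i generalizing u with
  | zero =>
    have : u ≠ 0 := by rintro rfl; simp at h
    simp [lineKernel, this]
  | succ i ih =>
    obtain ⟨c, hc⟩ := h
    push_cast at hc
    simp only [lineKernel]
    rw [ih (u - 1) ⟨c - 1, by linarith⟩, ih (u + 1) ⟨c, by linarith⟩]
    norm_num

lemma lineKernel_eq_zero_of_lt (i : ℕ) (u : ℤ) (h : u < -i) : lineKernel i u = 0 := by
  induction i generalizing u with
  | zero =>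
    have : u ≠ 0 := by rintro rfl; simp at h
    simp [lineKernel, this]
  | succ i ih =>
    push_cast at h
    simp only [lineKernel]
    rw [ih (u - 1) (by linarith), ih (u + 1) (by linarith)]
    norm_num

lemma lineKernel_eq_choose (i m : ℕ) :
    lineKernel i (2 * m - i) = (i.choose m : ℝ) / 2 ^ i := by
  induction i generalizing m with
  | zero =>
    cases m with
    | zero => simp [lineKernel]
    | succ m =>
      have : (2 * ((m + 1 : ℕ) : ℤ) - ((0 : ℕ) : ℤ)) ≠ 0 := by push_cast; omega
      simp only [lineKernel, this]
      simp
  | succ i ih =>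
    simp only [lineKernel]
    have h2 : (2 * (m : ℤ) - ((i + 1 : ℕ) : ℤ) + 1) = 2 * m - i := by push_cast; ring
    rw [h2, ih m]
    cases m with
    | zero =>
      rw [lineKernel_eq_zero_of_lt i _ (by push_cast; omega)]
      simp [pow_succ]
      field_simp
    | succ m =>
      have h1 : (2 * ((m + 1 : ℕ) : ℤ) - ((i + 1 : ℕ) : ℤ) - 1) = 2 * m - i := by push_cast; ring
      rw [h1, ih m, Nat.choose_succ_succ]
      push_cast
      rw [pow_succ]
      field_simp

lemma lineKernel_two_mul (j s : ℕ) :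
    lineKernel (2 * j) (2 * s) = ((2 * j).choose (j + s) : ℝ) / 2 ^ (2 * j) := by
  rw [← lineKernel_eq_choose]
  congr 1
  push_cast
  ring

lemma choose_central_lower (j s : ℕ) :
    ((2 * j).choose j : ℝ) * (j - s ^ 2) ≤ (2 * j).choose (j + s) * j := by
  induction s with
  | zero => simp
  | succ s ih =>
    have hc : (0 : ℝ) ≤ (2 * j).choose j := by positivity
    by_cases h : (j : ℝ) ≤ (s + 1) ^ 2
    · have : (((2 * j).choose j : ℝ)) * (j - ((s + 1 : ℕ) : ℝ) ^ 2) ≤ 0 :=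
        mul_nonpos_of_nonneg_of_nonpos hc (by push_cast; linarith)
      exact this.trans (by positivity)
    · push Not at h
      have hs0 : (0 : ℝ) ≤ s := by positivity
      have hsj : (s : ℝ) ≤ j := by nlinarith
      have hsj' : s ≤ j := by exact_mod_cast hsj
      have key := Nat.choose_succ_right_eq (2 * j) (j + s)
      have hsub : 2 * j - (j + s) = j - s := by omega
      rw [hsub] at key
      have key' : ((2 * j).choose (j + s + 1) : ℝ) * (j + s + 1) =
          (2 * j).choose (j + s) * (j - s) := by
        have := congrArg (Nat.cast : ℕ → ℝ) key
        push_cast [Nat.cast_sub hsj'] at this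
        exact this
      have hpos : (0 : ℝ) < j + s + 1 := by positivity
      rw [← add_assoc]
      push_cast
      have h1 : ((2 * j).choose (j + s) : ℝ) * j * (j - s) ≥
          ((2 * j).choose j : ℝ) * (j - s ^ 2) * (j - s) :=
        mul_le_mul_of_nonneg_right ih (by linarith)
      have h2 : ((2 * j).choose j : ℝ) * ((j - s ^ 2) * (j - s)) ≥
          ((2 * j).choose j : ℝ) * ((j - (s + 1) ^ 2) * (j + s + 1)) :=
        mul_le_mul_of_nonneg_left (by nlinarith [mul_nonneg hs0 hs0, mul_nonneg hs0 (mul_nonneg hs0 hs0)]) hc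
      refine le_of_mul_le_mul_right ?_ hpos
      nlinarith

lemma lineKernel_lower (j : ℕ) (s : ℤ) :
    lineKernel (2 * j) 0 * (j - s ^ 2) ≤ lineKernel (2 * j) (2 * s) * j := by
  have aux : ∀ m : ℕ, lineKernel (2 * j) 0 * (j - (m : ℝ) ^ 2) ≤
      lineKernel (2 * j) (2 * (m : ℤ)) * j := by
    intro m
    have h0 := lineKernel_two_mul j 0
    simp only [Nat.cast_zero, mul_zero, add_zero] at h0
    rw [lineKernel_two_mul, h0, div_mul_eq_mul_div, div_mul_eq_mul_div]
    exact div_le_div_of_nonneg_right (choose_central_lower j m) (by positivity)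
  obtain ⟨m, rfl | rfl⟩ := s.eq_nat_or_neg
  · exact_mod_cast aux m
  · rw [mul_neg, lineKernel_neg]
    have := aux m
    push_cast at this ⊢
    rwa [neg_sq]

/-- The probability that the planar walk is back at its starting point after `2 * j` steps. -/
noncomputable def returnProb (j : ℕ) : ℝ := lineKernel (2 * j) 0 ^ 2

lemma returnProb_nonneg (j : ℕ) : 0 ≤ returnProb j := sq_nonneg _

lemma lineKernel_zero_eq (j : ℕ) : lineKernel (2 * j) 0 = (j.centralBinom : ℝ) / 4 ^ j := by
  have h0 := lineKernel_two_mul j 0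
  simp only [Nat.cast_zero, mul_zero, add_zero] at h0
  rw [h0, Nat.centralBinom_eq_two_mul_choose, pow_mul]
  norm_num

lemma returnProb_succ (j : ℕ) :
    returnProb (j + 1) = returnProb j * ((2 * j + 1) / (2 * (j + 1))) ^ 2 := by
  unfold returnProb
  rw [← mul_pow, lineKernel_zero_eq, lineKernel_zero_eq]
  congr 1
  have := congrArg (Nat.cast : ℕ → ℝ) (Nat.succ_mul_centralBinom_succ j)
  push_cast at this
  have hj : (0 : ℝ) < j + 1 := by positivity
  rw [pow_succ]
  field_simp
  linarith

lemma returnProb_zero : returnProb 0 = 1 := by simp [returnProb, lineKernel]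

lemma returnProb_le (j : ℕ) : returnProb j ≤ 1 / (j + 1) := by
  induction j with
  | zero => simp [returnProb_zero]
  | succ j ih =>
    rw [returnProb_succ]
    refine (mul_le_mul_of_nonneg_right ih (sq_nonneg _)).trans ?_
    push_cast
    rw [div_pow, div_mul_div_comm, div_le_div_iff₀ (by positivity) (by positivity)]
    have hj : (0 : ℝ) ≤ j := by positivity
    nlinarith [mul_nonneg hj hj]

lemma le_returnProb (j : ℕ) : 1 / (4 * ((j : ℝ) + 1)) ≤ returnProb j := by
  have aux : ∀ i : ℕ, 1 / (4 * ((i : ℝ) + 1)) ≤ returnProb (i + 1) := by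
    intro i
    induction i with
    | zero => rw [returnProb_succ, returnProb_zero]; norm_num
    | succ i ih =>
      rw [returnProb_succ]
      refine le_trans ?_ (mul_le_mul_of_nonneg_right ih (sq_nonneg _))
      push_cast
      rw [div_pow, div_mul_div_comm, div_le_div_iff₀ (by positivity) (by positivity)]
      have hj : (0 : ℝ) ≤ i := by positivity
      nlinarith [mul_nonneg hj hj]
  cases j with
  | zero => rw [returnProb_zero]; norm_num
  | succ i =>
    refine le_trans ?_ (aux i)
    push_cast
    gcongr
    linarith

/-! ### The planar walk and its Green function -/

/-- The average of `f` over the four neighbours of `x`. -/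
noncomputable def nbrAvg (f : (Fin 2 → ℤ) → ℝ) (x : Fin 2 → ℤ) : ℝ :=
  (∑ a : Fin 2 × Bool, f (x + step a)) / 4

lemma nbrAvg_mono {f g : (Fin 2 → ℤ) → ℝ} {x : Fin 2 → ℤ}
    (h : ∀ a : Fin 2 × Bool, f (x + step a) ≤ g (x + step a)) : nbrAvg f x ≤ nbrAvg g x := by
  unfold nbrAvg
  have := Finset.sum_le_sum (s := Finset.univ) fun a _ => h a
  linarith

lemma nbrAvg_const (c : ℝ) (x : Fin 2 → ℤ) : nbrAvg (fun _ => c) x = c := by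
  simp [nbrAvg]

lemma nbrAvg_add (f g : (Fin 2 → ℤ) → ℝ) (x : Fin 2 → ℤ) :
    nbrAvg (fun y => f y + g y) x = nbrAvg f x + nbrAvg g x := by
  simp [nbrAvg, Finset.sum_add_distrib, add_div]

lemma nbrAvg_sub (f g : (Fin 2 → ℤ) → ℝ) (x : Fin 2 → ℤ) :
    nbrAvg (fun y => f y - g y) x = nbrAvg f x - nbrAvg g x := by
  simp [nbrAvg, Finset.sum_sub_distrib, sub_div]

lemma nbrAvg_const_mul (c : ℝ) (f : (Fin 2 → ℤ) → ℝ) (x : Fin 2 → ℤ) :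
    nbrAvg (fun y => c * f y) x = c * nbrAvg f x := by
  simp only [nbrAvg, ← Finset.mul_sum, mul_div_assoc]

lemma nbrAvg_sum {ι : Type*} (s : Finset ι) (f : ι → (Fin 2 → ℤ) → ℝ) (x : Fin 2 → ℤ) :
    nbrAvg (fun y => ∑ i ∈ s, f i y) x = ∑ i ∈ s, nbrAvg (f i) x := by
  simp only [nbrAvg]
  rw [Finset.sum_comm, Finset.sum_div]

lemma abs_step_le (a : Fin 2 × Bool) (i : Fin 2) : |step a i| ≤ 1 := by
  unfold step
  split_ifs <;> simp

/-- The probability that the walk started at `0` is at `x` after `i` steps.  The two coordinates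
`x 0 + x 1` and `x 0 - x 1` perform independent walks on `ℤ`. -/
noncomputable def kernel (i : ℕ) (x : Fin 2 → ℤ) : ℝ :=
  lineKernel i (x 0 + x 1) * lineKernel i (x 0 - x 1)

lemma kernel_nonneg (i : ℕ) (x : Fin 2 → ℤ) : 0 ≤ kernel i x :=
  mul_nonneg (lineKernel_nonneg _ _) (lineKernel_nonneg _ _)

lemma kernel_zero (x : Fin 2 → ℤ) : kernel 0 x = if x = 0 then 1 else 0 := by
  have : x = 0 ↔ x 0 + x 1 = 0 ∧ x 0 - x 1 = 0 := by
    constructor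
    · rintro rfl; simp
    · rintro ⟨h1, h2⟩
      funext i
      fin_cases i <;> simp <;> omega
  simp only [kernel, lineKernel, this]
  split_ifs <;> simp_all

lemma kernel_succ (i : ℕ) (x : Fin 2 → ℤ) : kernel (i + 1) x = nbrAvg (kernel i) x := by
  simp only [kernel, nbrAvg, lineKernel, Fintype.sum_prod_type, Fin.sum_univ_two,
    Fintype.sum_bool, Pi.add_apply, step]
  simp
  have e1 : x 0 + 1 + x 1 = x 0 + x 1 + 1 := by ring
  have e2 : x 0 + 1 - x 1 = x 0 - x 1 + 1 := by ring
  have e3 : x 0 + -1 + x 1 = x 0 + x 1 - 1 := by ring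
  have e4 : x 0 + -1 - x 1 = x 0 - x 1 - 1 := by ring
  have e5 : x 0 + (x 1 + 1) = x 0 + x 1 + 1 := by ring
  have e6 : x 0 - (x 1 + 1) = x 0 - x 1 - 1 := by ring
  have e7 : x 0 + (x 1 + -1) = x 0 + x 1 - 1 := by ring
  have e8 : x 0 - (x 1 + -1) = x 0 - x 1 + 1 := by ring
  rw [e1, e2, e3, e4, e5, e6, e7, e8]
  ring

/-- The probability of being at `x` at time `2 * j` or at time `2 * j + 1`: by parity only one of
the two terms is non-zero. -/
noncomputable def pairKernel (j : ℕ) (x : Fin 2 → ℤ) : ℝ := kernel (2 * j) x + kernel (2 * j + 1) x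

lemma pairKernel_nonneg (j : ℕ) (x : Fin 2 → ℤ) : 0 ≤ pairKernel j x :=
  add_nonneg (kernel_nonneg _ _) (kernel_nonneg _ _)

lemma pairKernel_zero_right (j : ℕ) : pairKernel j 0 = returnProb j := by
  have : lineKernel (2 * j + 1) 0 = 0 := lineKernel_eq_zero_of_odd _ _ ⟨j, by push_cast; ring⟩
  simp [pairKernel, kernel, this, returnProb, sq]

lemma kernel_even_lower {j : ℕ} {x : Fin 2 → ℤ} {R : ℕ} (hx : ∀ i, |x i| ≤ R)
    (he : Even (x 0 + x 1)) :
    returnProb j * (j - 2 * (R : ℝ) ^ 2) ≤ kernel (2 * j) x * j := by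
  obtain ⟨s, hs⟩ := he
  have hs' : x 0 + x 1 = 2 * s := by omega
  obtain ⟨r, hr⟩ : ∃ r, x 0 - x 1 = 2 * r := ⟨s - x 1, by omega⟩
  have h0 := abs_le.1 (hx 0)
  have h1 := abs_le.1 (hx 1)
  have hsR : (s : ℝ) ^ 2 ≤ (R : ℝ) ^ 2 := by
    apply sq_le_sq'
    · have : -(R : ℤ) ≤ s := by omega
      exact_mod_cast this
    · have : s ≤ (R : ℤ) := by omega
      exact_mod_cast this
  have hrR : (r : ℝ) ^ 2 ≤ (R : ℝ) ^ 2 := by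
    apply sq_le_sq'
    · have : -(R : ℤ) ≤ r := by omega
      exact_mod_cast this
    · have : r ≤ (R : ℤ) := by omega
      exact_mod_cast this
  have hk : kernel (2 * j) x = lineKernel (2 * j) (2 * s) * lineKernel (2 * j) (2 * r) := by
    rw [kernel, hs', hr]
  rcases Nat.eq_zero_or_pos j with rfl | hj
  · simp only [Nat.cast_zero, mul_zero, zero_sub]
    have := mul_nonneg (returnProb_nonneg 0) (sq_nonneg (R : ℝ))
    linarith
  have hj0 : (0 : ℝ) < j := by exact_mod_cast hj
  by_cases hc : (j : ℝ) ≤ 2 * (R : ℝ) ^ 2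
  · have h : returnProb j * (j - 2 * (R : ℝ) ^ 2) ≤ 0 :=
      mul_nonpos_of_nonneg_of_nonpos (returnProb_nonneg j) (by linarith)
    exact h.trans (mul_nonneg (kernel_nonneg _ _) hj0.le)
  · push Not at hc
    have hR0 := sq_nonneg (R : ℝ)
    have hb : 0 ≤ lineKernel (2 * j) 0 := lineKernel_nonneg _ _
    have A := lineKernel_lower j s
    have B := lineKernel_lower j r
    have hA : 0 ≤ lineKernel (2 * j) 0 * (j - (s : ℝ) ^ 2) := mul_nonneg hb (by linarith)
    have hB : 0 ≤ lineKernel (2 * j) 0 * (j - (r : ℝ) ^ 2) := mul_nonneg hb (by linarith)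
    have AB := mul_le_mul A B hB (hA.trans A)
    have C : returnProb j * (j - 2 * (R : ℝ) ^ 2) * j ≤
        returnProb j * ((j - (s : ℝ) ^ 2) * (j - (r : ℝ) ^ 2)) := by
      rw [mul_assoc]
      refine mul_le_mul_of_nonneg_left ?_ (returnProb_nonneg j)
      nlinarith [mul_nonneg (sq_nonneg (s : ℝ)) (sq_nonneg (r : ℝ))]
    refine le_of_mul_le_mul_right ?_ hj0
    rw [hk]
    refine C.trans ?_
    unfold returnProb
    nlinarith

lemma pairKernel_lower {j : ℕ} {x : Fin 2 → ℤ} {R : ℕ} (hR : 1 ≤ R) (hx : ∀ i, |x i| ≤ R) :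
    returnProb j * (j - 8 * (R : ℝ) ^ 2) ≤ pairKernel j x * j := by
  have hR' : (1 : ℝ) ≤ R := by exact_mod_cast hR
  have hj : (0 : ℝ) ≤ j := by positivity
  rcases Int.even_or_odd (x 0 + x 1) with he | ho
  · have h1 := kernel_even_lower (j := j) hx he
    have h2 : returnProb j * (j - 8 * (R : ℝ) ^ 2) ≤ returnProb j * (j - 2 * (R : ℝ) ^ 2) :=
      mul_le_mul_of_nonneg_left (by nlinarith) (returnProb_nonneg j)
    have h3 := mul_nonneg (kernel_nonneg (2 * j + 1) x) hj
    unfold pairKernel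
    linarith
  · have key : returnProb j * (j - 8 * (R : ℝ) ^ 2) ≤ kernel (2 * j + 1) x * j := by
      have h4 : returnProb j * (j - 8 * (R : ℝ) ^ 2) ≤ nbrAvg (fun y => j * kernel (2 * j) y) x := by
        rw [← nbrAvg_const (returnProb j * (j - 8 * (R : ℝ) ^ 2)) x]
        refine nbrAvg_mono fun a => ?_
        have hb : ∀ i, |(x + step a) i| ≤ ((R + 1 : ℕ) : ℤ) := by
          intro i
          have := abs_add_le (x i) (step a i)
          have := hx i
          have := abs_step_le a i
          push_cast
          simp only [Pi.add_apply]
          linarith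
        have he : Even ((x + step a) 0 + (x + step a) 1) := by
          have : Odd (step a 0 + step a 1) := by
            obtain ⟨i, b⟩ := a
            fin_cases i <;> cases b <;> simp [step]
          have := ho.add_odd this
          simp only [Pi.add_apply]
          rwa [add_add_add_comm]
        have h1 := kernel_even_lower (j := j) hb he
        have h2 : returnProb j * (j - 8 * (R : ℝ) ^ 2) ≤
            returnProb j * (j - 2 * ((R + 1 : ℕ) : ℝ) ^ 2) := by
          refine mul_le_mul_of_nonneg_left ?_ (returnProb_nonneg j)
          push_cast
          nlinarith
        linarith
      rw [nbrAvg_const_mul, ← kernel_succ] at h4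
      linarith
    have h3 := mul_nonneg (kernel_nonneg (2 * j) x) hj
    unfold pairKernel
    linarith

/-- The expected number of visits to `0` up to time `t` of the walk started at `x`. -/
noncomputable def green (t : ℕ) (x : Fin 2 → ℤ) : ℝ := ∑ i ∈ Finset.range (t + 1), kernel i x

lemma green_succ (t : ℕ) (x : Fin 2 → ℤ) :
    green (t + 1) x = (if x = 0 then 1 else 0) + nbrAvg (green t) x := by
  have h : nbrAvg (green t) x = ∑ i ∈ Finset.range (t + 1), nbrAvg (kernel i) x :=
    nbrAvg_sum _ _ _
  rw [h, green, Finset.sum_range_succ', kernel_zero, add_comm]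
  simp only [kernel_succ]

lemma green_nonneg (t : ℕ) (x : Fin 2 → ℤ) : 0 ≤ green t x :=
  Finset.sum_nonneg fun _ _ => kernel_nonneg _ _

lemma green_mono (x : Fin 2 → ℤ) : Monotone fun t => green t x := by
  refine monotone_nat_of_le_succ fun t => ?_
  simp only [green]
  rw [Finset.sum_range_succ _ (t + 1)]
  linarith [kernel_nonneg (t + 1) x]

lemma green_eq_sum_pairKernel (J : ℕ) (x : Fin 2 → ℤ) :
    green (2 * J + 1) x = ∑ j ∈ Finset.range (J + 1), pairKernel j x := by
  induction J with
  | zero => simp [green, pairKernel, Finset.sum_range_succ]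
  | succ J ih =>
    rw [Finset.sum_range_succ, ← ih, pairKernel]
    simp only [green]
    rw [show 2 * (J + 1) + 1 + 1 = 2 * J + 1 + 1 + 1 + 1 by ring, Finset.sum_range_succ,
      Finset.sum_range_succ]
    rw [show 2 * (J + 1) = 2 * J + 1 + 1 by ring]
    ring

lemma sum_inv_succ_eq_harmonic (n : ℕ) :
    ∑ j ∈ Finset.range n, 1 / ((j : ℝ) + 1) = (harmonic n : ℝ) := by
  simp [harmonic]

/-- The potential-kernel estimate: `green t 0 - green t x` is at most logarithmic in `x`. -/
lemma green_zero_sub_le {x : Fin 2 → ℤ} {R : ℕ} (hR : 1 ≤ R) (hx : ∀ i, |x i| ≤ R) (J : ℕ) :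
    green (2 * J + 1) 0 - green (2 * J + 1) x ≤ 2 + Real.log (8 * (R : ℝ) ^ 2) := by
  rw [green_eq_sum_pairKernel, green_eq_sum_pairKernel, ← Finset.sum_sub_distrib]
  generalize J + 1 = N
  set d : ℕ → ℝ := fun j => pairKernel j 0 - pairKernel j x with hd
  set ρ : ℕ := 8 * R ^ 2 with hρ
  have hρ1 : 1 ≤ ρ := by have := Nat.one_le_pow 2 R hR; omega
  have hρc : (ρ : ℝ) = 8 * (R : ℝ) ^ 2 := by rw [hρ]; push_cast; ring
  have hρ0 : (1 : ℝ) ≤ ρ := by exact_mod_cast hρ1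
  have h1 : ∀ j, d j ≤ 1 / ((j : ℝ) + 1) := by
    intro j
    have := returnProb_le j
    have := pairKernel_nonneg j x
    simp only [hd, pairKernel_zero_right]
    linarith
  have h2 : ∀ j : ℕ, 1 ≤ j → d j ≤ ρ / j - ρ / ((j : ℝ) + 1) := by
    intro j hj
    have hj0 : (0 : ℝ) < j := by exact_mod_cast hj
    have A := pairKernel_lower (j := j) hR hx
    rw [← hρc] at A
    have B : returnProb j * ρ ≤ 1 / ((j : ℝ) + 1) * ρ :=
      mul_le_mul_of_nonneg_right (returnProb_le j) (by linarith)
    have C : d j * j ≤ 1 / ((j : ℝ) + 1) * ρ := by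
      simp only [hd, pairKernel_zero_right]
      linarith
    have D : (ρ : ℝ) / j - ρ / ((j : ℝ) + 1) = (1 / ((j : ℝ) + 1) * ρ) / j := by
      field_simp
      ring
    rw [D, le_div_iff₀ hj0]
    exact C
  have h3 : ∀ m, ∑ j ∈ Finset.range (ρ + m), d j ≤ harmonic ρ + (1 - ρ / ((ρ + m : ℕ) : ℝ)) := by
    intro m
    induction m with
    | zero =>
      rw [add_zero, div_self (by positivity), sub_self, add_zero, ← sum_inv_succ_eq_harmonic]
      exact Finset.sum_le_sum fun j _ => h1 j
    | succ m ih =>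
      rw [← add_assoc, Finset.sum_range_succ]
      have := h2 (ρ + m) (by omega)
      push_cast at this ih ⊢
      linarith
  have h4 : (harmonic ρ : ℝ) ≤ 1 + Real.log (8 * (R : ℝ) ^ 2) := by
    rw [← hρc]; exact harmonic_le_one_add_log ρ
  rcases le_total N ρ with h | h
  · have : ∑ j ∈ Finset.range N, d j ≤ harmonic ρ := by
      rw [← sum_inv_succ_eq_harmonic]
      refine (Finset.sum_le_sum fun j _ => h1 j).trans ?_
      exact Finset.sum_le_sum_of_subset_of_nonneg (Finset.range_mono h)
        fun j _ _ => by positivity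
    linarith
  · obtain ⟨m, rfl⟩ := Nat.exists_eq_add_of_le h
    have := h3 m
    have : (0 : ℝ) ≤ ρ / ((ρ + m : ℕ) : ℝ) := by positivity
    linarith

lemma log_le_green_zero (J : ℕ) : Real.log (J + 2) / 4 ≤ green (2 * J + 1) 0 := by
  rw [green_eq_sum_pairKernel]
  have h := log_add_one_le_harmonic (J + 1)
  rw [← sum_inv_succ_eq_harmonic] at h
  have : ∑ j ∈ Finset.range (J + 1), 1 / ((j : ℝ) + 1) ≤
      ∑ j ∈ Finset.range (J + 1), 4 * pairKernel j 0 := by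
    refine Finset.sum_le_sum fun j _ => ?_
    rw [pairKernel_zero_right]
    have := le_returnProb j
    rw [one_div, mul_inv] at this
    rw [one_div]
    linarith
  rw [← Finset.mul_sum] at this
  push_cast at h
  rw [show (J : ℝ) + 1 + 1 = J + 2 by ring] at h
  linarith

/-! ### Avoiding a point -/

/-- The probability that the walk started at `x` does not visit `y` up to time `t`. -/
noncomputable def avoidProb (y : Fin 2 → ℤ) : ℕ → (Fin 2 → ℤ) → ℝ
  | 0, x => if x = y then 0 else 1
  | t + 1, x => if x = y then 0 else nbrAvg (avoidProb y t) x

lemma avoidProb_self (y : Fin 2 → ℤ) (t : ℕ) : avoidProb y t y = 0 := by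
  cases t <;> simp [avoidProb]

lemma avoidProb_nonneg (y : Fin 2 → ℤ) (t : ℕ) (x : Fin 2 → ℤ) : 0 ≤ avoidProb y t x := by
  induction t generalizing x with
  | zero => unfold avoidProb; split_ifs <;> norm_num
  | succ t ih =>
    unfold avoidProb
    split_ifs
    · exact le_rfl
    · rw [← nbrAvg_const 0 x]
      exact nbrAvg_mono fun a => ih _

lemma avoidProb_le_one (y : Fin 2 → ℤ) (t : ℕ) (x : Fin 2 → ℤ) : avoidProb y t x ≤ 1 := by
  induction t generalizing x with
  | zero => unfold avoidProb; split_ifs <;> norm_num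
  | succ t ih =>
    unfold avoidProb
    split_ifs
    · norm_num
    · rw [← nbrAvg_const 1 x]
      exact nbrAvg_mono fun a => ih _

lemma avoidProb_antitone (y x : Fin 2 → ℤ) : Antitone fun t => avoidProb y t x := by
  refine antitone_nat_of_succ_le fun t => ?_
  induction t generalizing x with
  | zero =>
    by_cases h : x = y
    · simp [avoidProb, h]
    · simpa [avoidProb, h] using avoidProb_le_one y 1 x
  | succ t ih =>
    by_cases h : x = y
    · simp [avoidProb, h]
    · unfold avoidProb
      simp only [h, if_false]
      exact nbrAvg_mono fun a => ih _

lemma green_le_hit_mul (y : Fin 2 → ℤ) (t : ℕ) (x : Fin 2 → ℤ) :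
    green t (x - y) ≤ (1 - avoidProb y t x) * green t 0 := by
  induction t generalizing x with
  | zero =>
    by_cases h : x = y
    · simp [avoidProb, h]
    · simp [avoidProb, h, green, kernel_zero, sub_eq_zero]
  | succ t ih =>
    by_cases h : x = y
    · simp [avoidProb, h]
    · have h0 : x - y ≠ 0 := sub_ne_zero.2 h
      rw [green_succ, if_neg h0, zero_add]
      have e : nbrAvg (green t) (x - y) = nbrAvg (fun z => green t (z - y)) x := by
        unfold nbrAvg
        congr 1
        refine Finset.sum_congr rfl fun a _ => ?_
        congr 1
        abel
      rw [e]
      have h1 : nbrAvg (fun z => green t (z - y)) x ≤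
          nbrAvg (fun z => green t 0 * (1 - avoidProb y t z)) x :=
        nbrAvg_mono fun a => by rw [mul_comm]; exact ih _
      rw [nbrAvg_const_mul, nbrAvg_sub, nbrAvg_const] at h1
      have h2 : avoidProb y (t + 1) x = nbrAvg (avoidProb y t) x := by
        rw [avoidProb, if_neg h]
      have h3 := avoidProb_le_one y (t + 1) x
      have h4 := mul_le_mul_of_nonneg_right (green_mono 0 (Nat.le_succ t)) (sub_nonneg.2 h3)
      rw [h2] at h4 ⊢
      simp only at h4
      have h5 : nbrAvg (fun y_1 => avoidProb y t y_1) x = nbrAvg (avoidProb y t) x := rfl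
      rw [h5] at h1
      refine h1.trans (h4.trans ?_)
      rw [mul_comm]

lemma avoidProb_le {x y : Fin 2 → ℤ} {R t : ℕ} (hR : 2 ≤ R) (ht : 2 ≤ t)
    (hx : ∀ i, |x i - y i| ≤ R) :
    avoidProb y t x ≤ 64 * (Real.log R / Real.log t) := by
  obtain ⟨J, hJ⟩ : ∃ J, t = 2 * J + 1 ∨ t = 2 * J + 2 := ⟨(t - 1) / 2, by omega⟩
  have hle : avoidProb y t x ≤ avoidProb y (2 * J + 1) x :=
    avoidProb_antitone y x (by omega)
  refine hle.trans ?_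
  have ht2 : (2 : ℝ) ≤ t := by exact_mod_cast ht
  have hlt : 0 < Real.log t := Real.log_pos (by linarith)
  have hR2 : (2 : ℝ) ≤ R := by exact_mod_cast hR
  have hlog2 : 0.69 < Real.log 2 := by linarith [Real.log_two_gt_d9]
  have hlR : Real.log 2 ≤ Real.log R := Real.log_le_log (by norm_num) hR2
  have hJt : (t : ℝ) ≤ ((J : ℝ) + 2) ^ 2 := by
    have : (t : ℝ) ≤ 2 * J + 2 := by
      have : t ≤ 2 * J + 2 := by omega
      exact_mod_cast this
    nlinarith [sq_nonneg (J : ℝ), (Nat.cast_nonneg J : (0 : ℝ) ≤ J)]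
  have h1 : Real.log t ≤ 2 * Real.log (J + 2) := by
    have := Real.log_le_log (by linarith) hJt
    rwa [Real.log_pow] at this
  have h2 := log_le_green_zero J
  have h3 := green_zero_sub_le (x := x - y) (by omega : 1 ≤ R) hx J
  have h4 := green_le_hit_mul y (2 * J + 1) x
  have h5 : Real.log (8 * (R : ℝ) ^ 2) = 3 * Real.log 2 + 2 * Real.log R := by
    rw [Real.log_mul (by norm_num) (by positivity), Real.log_pow,
      show (8 : ℝ) = 2 ^ 3 by norm_num, Real.log_pow]
    push_cast
    ring
  have h6 : avoidProb y (2 * J + 1) x * green (2 * J + 1) 0 ≤ 8 * Real.log R := by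
    linarith
  have h7 := mul_le_mul_of_nonneg_left (h1.trans (by linarith : _ ≤ 8 * green (2 * J + 1) 0))
    (avoidProb_nonneg y (2 * J + 1) x)
  rw [← mul_div_assoc, le_div_iff₀ hlt]
  linarith

/-! ### Covering a finite set -/

/-- The probability that the walk started at `x` has not visited all points of `U` by time `t`. -/
noncomputable def uncoverProb : ℕ → (Fin 2 → ℤ) → Finset (Fin 2 → ℤ) → ℝ
  | 0, x, U => if U.erase x = ∅ then 0 else 1
  | t + 1, x, U => nbrAvg (fun y => uncoverProb t y (U.erase x)) x

lemma uncoverProb_le_one (t : ℕ) (x : Fin 2 → ℤ) (U : Finset (Fin 2 → ℤ)) :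
    uncoverProb t x U ≤ 1 := by
  induction t generalizing x U with
  | zero => unfold uncoverProb; split_ifs <;> norm_num
  | succ t ih =>
    unfold uncoverProb
    rw [← nbrAvg_const 1 x]
    exact nbrAvg_mono fun a => ih _ _

lemma uncoverProb_erase (t : ℕ) (x : Fin 2 → ℤ) (U : Finset (Fin 2 → ℤ)) :
    uncoverProb t x (U.erase x) = uncoverProb t x U := by
  cases t <;> simp [uncoverProb]

lemma sum_avoidProb_zero (x : Fin 2 → ℤ) (U : Finset (Fin 2 → ℤ)) :
    ∑ y ∈ U, avoidProb y 0 x = ((U.erase x).card : ℝ) := by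
  rw [← Finset.sum_erase (f := fun y => avoidProb y 0 x) U (avoidProb_self x 0), Finset.card_eq_sum_ones]
  push_cast
  refine Finset.sum_congr rfl fun y hy => ?_
  rw [avoidProb, if_neg (Finset.ne_of_mem_erase hy).symm]

lemma sum_avoidProb_succ (t : ℕ) (x : Fin 2 → ℤ) (U : Finset (Fin 2 → ℤ)) :
    ∑ y ∈ U, avoidProb y (t + 1) x =
      nbrAvg (fun z => ∑ y ∈ U.erase x, avoidProb y t z) x := by
  rw [← Finset.sum_erase (f := fun y => avoidProb y (t + 1) x) U (avoidProb_self x (t + 1)),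
    nbrAvg_sum]
  refine Finset.sum_congr rfl fun y hy => ?_
  rw [avoidProb, if_neg (Finset.ne_of_mem_erase hy).symm]

lemma uncoverProb_le_sum (t : ℕ) (x : Fin 2 → ℤ) (U : Finset (Fin 2 → ℤ)) :
    uncoverProb t x U ≤ ∑ y ∈ U, avoidProb y t x := by
  induction t generalizing x U with
  | zero =>
    rw [sum_avoidProb_zero, uncoverProb]
    split_ifs with h
    · positivity
    · exact_mod_cast Finset.one_le_card.2 (Finset.nonempty_iff_ne_empty.2 h)
  | succ t ih =>
    rw [sum_avoidProb_succ, uncoverProb]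
    exact nbrAvg_mono fun a => ih _ _

/-- The Markov property at the hitting time of `o`. -/
lemma uncoverProb_le_of_hit {o : Fin 2 → ℤ} {t : ℕ} {c : ℝ} (hc : 0 ≤ c)
    {U : Finset (Fin 2 → ℤ)} (h : ∀ t', t ≤ t' → ∀ U' ⊆ U, uncoverProb t' o U' ≤ c)
    (s : ℕ) (x : Fin 2 → ℤ) :
    uncoverProb (s + t) x U ≤ avoidProb o s x + c := by
  induction s generalizing x U with
  | zero =>
    by_cases hx : x = o
    · subst hx
      rw [avoidProb_self, zero_add, zero_add]
      exact h t le_rfl U subset_rfl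
    · rw [avoidProb, if_neg hx]
      linarith [uncoverProb_le_one (0 + t) x U]
  | succ s ih =>
    by_cases hx : x = o
    · subst hx
      rw [avoidProb_self, zero_add]
      exact h _ (by omega) U subset_rfl
    · rw [avoidProb, if_neg hx, show s + 1 + t = (s + t) + 1 by ring, uncoverProb,
        ← nbrAvg_const c x, ← nbrAvg_add]
      exact nbrAvg_mono fun a =>
        ih (fun t' ht' U' hU' => h t' ht' U' (hU'.trans (Finset.erase_subset _ _))) _

/-- The Markov property at the fixed time `K`, for a bound that is affine in the number of points
still to be visited. -/
lemma uncoverProb_le_of_run {o : Fin 2 → ℤ} {t K D : ℕ} {a b : ℝ}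
    {U : Finset (Fin 2 → ℤ)}
    (h : ∀ x', (∀ i, |x' i - o i| ≤ ((D + K : ℕ) : ℤ)) → ∀ U' ⊆ U,
      uncoverProb t x' U' ≤ a + b * U'.card)
    {x : Fin 2 → ℤ} (hx : ∀ i, |x i - o i| ≤ D) :
    uncoverProb (K + t) x U ≤ a + b * ∑ y ∈ U, avoidProb y K x := by
  induction K generalizing D x U with
  | zero =>
    rw [sum_avoidProb_zero, zero_add, ← uncoverProb_erase]
    exact h x (by simpa using hx) _ (Finset.erase_subset _ _)
  | succ K ih =>
    rw [sum_avoidProb_succ, show K + 1 + t = (K + t) + 1 by ring, uncoverProb,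
      ← nbrAvg_const_mul, ← nbrAvg_const a x, ← nbrAvg_add]
    refine nbrAvg_mono fun e => ?_
    refine ih (D := D + 1) (fun x' hx' U' hU' => h x' ?_ U' (hU'.trans (Finset.erase_subset _ _))) ?_
    · intro i
      have := hx' i
      push_cast at this ⊢
      linarith
    · intro i
      have h1 := hx i
      have h2 := abs_step_le e i
      have h3 := abs_add_le (x i - o i) (step e i)
      have h4 : (x + step e) i - o i = x i - o i + step e i := by simp only [Pi.add_apply]; ring
      rw [h4]
      push_cast
      linarith

/-- After `r` rounds, each consisting of `K` free steps and a return to `o`, the expected number of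
unvisited points has been halved `r` times unless one of the returns has failed. -/
lemma uncoverProb_rounds {o : Fin 2 → ℤ} {S : Finset (Fin 2 → ℤ)} {K s : ℕ} {α : ℝ} (hα : 0 ≤ α)
    (hK : ∀ y ∈ S, avoidProb y K o ≤ 1 / 2) (hs : ∀ y ∈ S, avoidProb y s o ≤ α)
    (hret : ∀ x : Fin 2 → ℤ, (∀ i, |x i - o i| ≤ K) → avoidProb o s x ≤ α)
    (r t : ℕ) (ht : r * (K + s) + s ≤ t) (U : Finset (Fin 2 → ℤ)) (hU : U ⊆ S) :
    uncoverProb t o U ≤ r * α + α / 2 ^ r * U.card := by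
  induction r generalizing t U with
  | zero =>
    refine (uncoverProb_le_sum t o U).trans ?_
    have : ∑ y ∈ U, avoidProb y t o ≤ ∑ _y ∈ U, α :=
      Finset.sum_le_sum fun y hy =>
        (avoidProb_antitone y o (by omega : s ≤ t)).trans (hs y (hU hy))
    rw [Finset.sum_const, nsmul_eq_mul] at this
    simp
    linarith
  | succ r ih =>
    obtain ⟨t', rfl⟩ : ∃ t', t = K + (s + t') :=
      ⟨t - (K + s), by have : (r + 1) * (K + s) = r * (K + s) + (K + s) := by ring
                       omega⟩
    have ht' : r * (K + s) + s ≤ t' := by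
      have : (r + 1) * (K + s) = r * (K + s) + (K + s) := by ring
      omega
    have key := uncoverProb_le_of_run (o := o) (t := s + t') (K := K) (D := 0)
      (a := (r + 1) * α) (b := α / 2 ^ r) (U := U) (x := o) ?_ (by simp)
    · have h1 : ∑ y ∈ U, avoidProb y K o ≤ ∑ _y ∈ U, (1 / 2 : ℝ) :=
        Finset.sum_le_sum fun y hy => hK y (hU hy)
      rw [Finset.sum_const, nsmul_eq_mul] at h1
      have h2 := mul_le_mul_of_nonneg_left h1 (by positivity : 0 ≤ α / 2 ^ r)
      have h3 : α / 2 ^ (r + 1) * U.card = α / 2 ^ r * (U.card * (1 / 2)) := by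
        rw [pow_succ]
        field_simp
      push_cast
      rw [h3]
      linarith
    · intro x' hx' U' hU'
      have hc : 0 ≤ r * α + α / 2 ^ r * U'.card := by positivity
      have := uncoverProb_le_of_hit (o := o) (t := t') hc (U := U') (fun t'' ht'' U'' hU'' => ?_) s x'
      · have := hret x' (by simpa using hx')
        linarith
      · refine (ih t'' (by omega) U'' (hU''.trans (hU'.trans hU))).trans ?_
        have : (U''.card : ℝ) ≤ U'.card := by exact_mod_cast Finset.card_le_card hU''
        gcongr

lemma uncoverProb_le_of_return {o : Fin 2 → ℤ} {S : Finset (Fin 2 → ℤ)} {K s : ℕ} {α : ℝ}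
    (hα : 0 ≤ α)
    (hK : ∀ y ∈ S, avoidProb y K o ≤ 1 / 2) (hs : ∀ y ∈ S, avoidProb y s o ≤ α)
    (hret : ∀ x : Fin 2 → ℤ, (∀ i, |x i - o i| ≤ K) → avoidProb o s x ≤ α)
    {r t : ℕ} (ht : (r + 2) * (K + s) ≤ t) (hr : S.card ≤ 2 ^ r)
    {x : Fin 2 → ℤ} (hx : ∀ i, |x i - o i| ≤ K) :
    uncoverProb t x S ≤ (r + 2) * α := by
  obtain ⟨t', rfl⟩ : ∃ t', t = s + t' := ⟨t - s, by
    have : (r + 2) * (K + s) = r * (K + s) + 2 * K + 2 * s := by ring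
    omega⟩
  have ht' : r * (K + s) + s ≤ t' := by
    have : (r + 2) * (K + s) = r * (K + s) + 2 * K + 2 * s := by ring
    omega
  have hc : 0 ≤ r * α + α := by positivity
  have := uncoverProb_le_of_hit (o := o) (t := t') hc (U := S) (fun t'' ht'' U hU => ?_) s x
  · have := hret x hx
    linarith
  · refine (uncoverProb_rounds hα hK hs hret r t'' (by omega) U hU).trans ?_
    have h1 : (U.card : ℝ) ≤ 2 ^ r := by exact_mod_cast (Finset.card_le_card hU).trans hr
    have h2 : α / 2 ^ r * U.card ≤ α / 2 ^ r * 2 ^ r := by gcongr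
    rw [div_mul_cancel₀ α (by positivity)] at h2
    linarith

/-! ### Squares -/

/-- The square of side length `2 * k + 1` centred at `z`, as a finite set. -/
noncomputable def box (z : Fin 2 → ℤ) (k : ℕ) : Finset (Fin 2 → ℤ) :=
  Fintype.piFinset fun i => Finset.Icc (z i - k) (z i + k)

lemma mem_box {z w : Fin 2 → ℤ} {k : ℕ} : w ∈ box z k ↔ ∀ i, |w i - z i| ≤ (k : ℤ) := by
  simp only [box, Fintype.mem_piFinset, Finset.mem_Icc, abs_le]
  refine forall_congr' fun i => ?_
  constructor <;> rintro ⟨h1, h2⟩ <;> constructor <;> linarith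

lemma card_box (z : Fin 2 → ℤ) (k : ℕ) : (box z k).card = (2 * k + 1) ^ 2 := by
  have h : ∀ i, z i + (k : ℤ) + 1 - (z i - k) = ((2 * k + 1 : ℕ) : ℤ) := by
    intro i; push_cast; ring
  simp only [box, Fintype.card_piFinset, Int.card_Icc, h, Int.toNat_natCast, Fin.prod_univ_two, sq]

lemma uncoverProb_box_le {k s t : ℕ} (hk : 2 ≤ k) (hs : k ^ 256 ≤ s) (ht : s ^ 2 ≤ t)
    {o x : Fin 2 → ℤ} (hx : x ∈ box o k) :
    uncoverProb t x (box o (k + 1)) ≤ 245760 * ((Real.log k) ^ 2 / Real.log s) := by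
  have hk0 : 0 < k := by omega
  have hpow : ∀ a b : ℕ, a ≤ b → k ^ a ≤ k ^ b := fun a b h => Nat.pow_le_pow_right hk0 h
  have hk1 : k + 1 ≤ k ^ 2 := by nlinarith
  have hkK : k ≤ k ^ 256 := by simpa using hpow 1 256 (by norm_num)
  have hk1K : k + 1 ≤ k ^ 256 := hk1.trans (hpow 2 256 (by norm_num))
  set K := k ^ 256 with hKdef
  have hk2 : (2 : ℝ) ≤ k := by exact_mod_cast hk
  have hlog2 : 0.69 < Real.log 2 := by linarith [Real.log_two_gt_d9]
  have hlk : Real.log 2 ≤ Real.log k := Real.log_le_log (by norm_num) hk2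
  have hlk0 : 0 < Real.log k := by linarith
  have hls : 0 < Real.log s := by
    apply Real.log_pos
    have : 1 < s := by omega
    exact_mod_cast this
  have hlK : Real.log K = 256 * Real.log k := by
    rw [hKdef]; push_cast; rw [Real.log_pow]; norm_num
  have hlk1 : Real.log ((k + 1 : ℕ) : ℝ) ≤ 2 * Real.log k := by
    have := Real.log_le_log (by positivity : (0 : ℝ) < ((k + 1 : ℕ) : ℝ))
      (by exact_mod_cast hk1 : ((k + 1 : ℕ) : ℝ) ≤ (k : ℝ) ^ 2)
    rwa [Real.log_pow] at this
  set α : ℝ := 64 * (Real.log K / Real.log s) with hα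
  have hα0 : 0 ≤ α := by
    rw [hα, hlK]
    positivity
  set L := Nat.log 2 k with hL
  have hL1 : 2 ^ L ≤ k := Nat.pow_log_le_self 2 (by omega)
  have hL2 : k < 2 ^ (L + 1) := Nat.lt_pow_succ_log_self (by norm_num) k
  have hLk : L ≤ k := Nat.log_le_self 2 k
  have hLlog : (L : ℝ) * Real.log 2 ≤ Real.log k := by
    have := Real.log_le_log (by positivity : (0 : ℝ) < 2 ^ L) (by exact_mod_cast hL1 : (2 : ℝ) ^ L ≤ k)
    rwa [Real.log_pow] at this
  have hsymm : ∀ y ∈ box o (k + 1), ∀ i, |o i - y i| ≤ ((k + 1 : ℕ) : ℤ) := by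
    intro y hy i
    rw [abs_sub_comm]
    exact mem_box.1 hy i
  have key := uncoverProb_le_of_return (o := o) (S := box o (k + 1)) (K := K) (s := s) (α := α)
    hα0 ?_ ?_ ?_ (r := 2 * (L + 3)) (t := t) ?_ ?_ (x := x) ?_
  · refine key.trans ?_
    have h1 : ((2 * (L + 3) : ℕ) : ℝ) + 2 ≤ 15 * Real.log k := by
      push_cast
      nlinarith
    have h2 := mul_le_mul_of_nonneg_right h1 hα0
    refine h2.trans (le_of_eq ?_)
    rw [hα, hlK]
    ring
  · intro y hy
    refine (avoidProb_le (R := k + 1) (by omega) (by omega) (hsymm y hy)).trans ?_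
    rw [hlK, ← mul_div_assoc, div_le_div_iff₀ (by positivity) (by norm_num)]
    linarith
  · intro y hy
    refine avoidProb_le (R := K) (by omega) (by omega) fun i => (hsymm y hy i).trans ?_
    exact_mod_cast hk1K
  · intro x' hx'
    exact avoidProb_le (R := K) (by omega) (by omega) hx'
  · have h5 : 12 * k ≤ k ^ 5 := by
      have : 2 ^ 4 ≤ k ^ 4 := Nat.pow_le_pow_left hk 4
      nlinarith
    have h6 : k ^ 5 ≤ s := (hpow 5 256 (by norm_num)).trans hs
    calc (2 * (L + 3) + 2) * (K + s) ≤ (6 * k) * (2 * s) :=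
          Nat.mul_le_mul (by omega) (by omega)
      _ = 12 * k * s := by ring
      _ ≤ s * s := Nat.mul_le_mul_right s (h5.trans h6)
      _ = s ^ 2 := by ring
      _ ≤ t := ht
  · rw [card_box, mul_comm 2 (L + 3), pow_mul]
    refine Nat.pow_le_pow_left ?_ 2
    have : 2 ^ (L + 3) = 4 * 2 ^ (L + 1) := by ring
    omega
  · intro i
    refine (mem_box.1 hx i).trans ?_
    exact_mod_cast hkK

/-! ### Occupation times and hitting probabilities -/

/-- The expected time spent in `Q` up to time `t` by the walk started at `x`. -/
noncomputable def occTime (Q : Finset (Fin 2 → ℤ)) (t : ℕ) (x : Fin 2 → ℤ) : ℝ :=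
  ∑ y ∈ Q, green t (x - y)

lemma nbrAvg_comp_sub (f : (Fin 2 → ℤ) → ℝ) (x y : Fin 2 → ℤ) :
    nbrAvg f (x - y) = nbrAvg (fun z => f (z - y)) x := by
  unfold nbrAvg
  congr 1
  refine Finset.sum_congr rfl fun a _ => ?_
  congr 1
  abel

lemma occTime_zero (Q : Finset (Fin 2 → ℤ)) (x : Fin 2 → ℤ) :
    occTime Q 0 x = if x ∈ Q then 1 else 0 := by
  simp [occTime, green, kernel_zero, sub_eq_zero]

lemma occTime_succ (Q : Finset (Fin 2 → ℤ)) (t : ℕ) (x : Fin 2 → ℤ) :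
    occTime Q (t + 1) x = (if x ∈ Q then 1 else 0) + nbrAvg (occTime Q t) x := by
  have : nbrAvg (occTime Q t) x = ∑ y ∈ Q, nbrAvg (green t) (x - y) := by
    simp only [nbrAvg_comp_sub]
    exact nbrAvg_sum _ _ _
  rw [this]
  simp [occTime, green_succ, Finset.sum_add_distrib, sub_eq_zero]

lemma occTime_nonneg (Q : Finset (Fin 2 → ℤ)) (t : ℕ) (x : Fin 2 → ℤ) : 0 ≤ occTime Q t x :=
  Finset.sum_nonneg fun _ _ => green_nonneg _ _

lemma occTime_mono (Q : Finset (Fin 2 → ℤ)) (x : Fin 2 → ℤ) : Monotone fun t => occTime Q t x :=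
  fun _ _ h => Finset.sum_le_sum fun y _ => green_mono (x - y) h

/-- The expected total time spent in disjoint sets up to time `t` is at most `t + 1`. -/
lemma sum_occTime_le {ι : Type*} {s : Finset ι} {Q : ι → Finset (Fin 2 → ℤ)}
    (hQ : ∀ x, ∑ z ∈ s, (if x ∈ Q z then (1 : ℝ) else 0) ≤ 1) (t : ℕ) (x : Fin 2 → ℤ) :
    ∑ z ∈ s, occTime (Q z) t x ≤ t + 1 := by
  induction t generalizing x with
  | zero => simpa [occTime_zero] using hQ x
  | succ t ih =>
    simp only [occTime_succ, Finset.sum_add_distrib]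
    rw [← nbrAvg_sum]
    have h1 : nbrAvg (fun y => ∑ z ∈ s, occTime (Q z) t y) x ≤ nbrAvg (fun _ => (t : ℝ) + 1) x :=
      nbrAvg_mono fun a => ih _
    rw [nbrAvg_const] at h1
    have := hQ x
    push_cast
    linarith

/-- The probability that the walk started at `x` visits `Q` up to time `t`. -/
noncomputable def hitProb (Q : Finset (Fin 2 → ℤ)) : ℕ → (Fin 2 → ℤ) → ℝ
  | 0, x => if x ∈ Q then 1 else 0
  | t + 1, x => if x ∈ Q then 1 else nbrAvg (hitProb Q t) x

lemma hitProb_nonneg (Q : Finset (Fin 2 → ℤ)) (t : ℕ) (x : Fin 2 → ℤ) : 0 ≤ hitProb Q t x := by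
  induction t generalizing x with
  | zero => unfold hitProb; split_ifs <;> norm_num
  | succ t ih =>
    unfold hitProb
    split_ifs
    · norm_num
    · rw [← nbrAvg_const 0 x]
      exact nbrAvg_mono fun a => ih _

/-- The strong Markov property at the first visit to `Q`, applied to the occupation time. -/
lemma mul_hitProb_le_occTime {Q : Finset (Fin 2 → ℤ)} {T : ℕ} {g : ℝ}
    (h : ∀ x ∈ Q, g ≤ occTime Q T x) (t : ℕ) (x : Fin 2 → ℤ) :
    g * hitProb Q t x ≤ occTime Q (t + T) x := by
  induction t generalizing x with
  | zero =>
    by_cases hx : x ∈ Q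
    · simpa [hitProb, hx] using h x hx
    · simpa [hitProb, hx] using occTime_nonneg Q T x
  | succ t ih =>
    by_cases hx : x ∈ Q
    · simpa [hitProb, hx] using (h x hx).trans (occTime_mono Q x (by omega : T ≤ t + 1 + T))
    · rw [hitProb, if_neg hx, show t + 1 + T = t + T + 1 by ring, occTime_succ, if_neg hx, zero_add,
        ← nbrAvg_const_mul]
      exact nbrAvg_mono fun a => ih _

lemma sum_hitProb_le {ι : Type*} {s : Finset ι} {Q : ι → Finset (Fin 2 → ℤ)}
    (hQ : ∀ x, ∑ z ∈ s, (if x ∈ Q z then (1 : ℝ) else 0) ≤ 1) {T : ℕ} {g : ℝ}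
    (h : ∀ z ∈ s, ∀ x ∈ Q z, g ≤ occTime (Q z) T x) (t : ℕ) (x : Fin 2 → ℤ) :
    g * ∑ z ∈ s, hitProb (Q z) t x ≤ t + T + 1 := by
  rw [Finset.mul_sum]
  refine (Finset.sum_le_sum fun z hz => mul_hitProb_le_occTime (h z hz) t x).trans ?_
  exact_mod_cast sum_occTime_le hQ (t + T) x

lemma le_occTime_box {k J : ℕ} (hk : 1 ≤ k) (hJ : 64 * k ^ 2 ≤ J + 1) {z x : Fin 2 → ℤ}
    (hx : x ∈ box z k) :
    (k : ℝ) ^ 2 / 2 * (Real.log (J + 2) - Real.log (64 * (k : ℝ) ^ 2 + 1)) ≤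
      occTime (box z k) (2 * J + 1) x := by
  have hk1 : (1 : ℝ) ≤ k := by exact_mod_cast hk
  set ℓ : ℝ := Real.log (J + 2) - Real.log (64 * (k : ℝ) ^ 2 + 1) with hℓ
  have hJ' : 64 * (k : ℝ) ^ 2 ≤ J + 1 := by exact_mod_cast hJ
  have hℓ0 : 0 ≤ ℓ := sub_nonneg.2 (Real.log_le_log (by positivity) (by linarith))
  have hg : ∀ y ∈ box z k, ℓ / 8 ≤ green (2 * J + 1) (x - y) := by
    intro y hy
    have hxy : ∀ i, |(x - y) i| ≤ ((2 * k : ℕ) : ℤ) := by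
      intro i
      have h1 := abs_le.1 (mem_box.1 hx i)
      have h2 := abs_le.1 (mem_box.1 hy i)
      simp only [Pi.sub_apply, abs_le]
      push_cast
      constructor <;> linarith
    have hterm : ∀ j : ℕ, 64 * k ^ 2 ≤ j →
        (Real.log (j + 2) - Real.log (j + 1)) / 8 ≤ pairKernel j (x - y) := by
      intro j hj
      have hj' : 64 * (k : ℝ) ^ 2 ≤ j := by exact_mod_cast hj
      have hj0 : (0 : ℝ) < j := by nlinarith
      have A := pairKernel_lower (j := j) (by omega : 1 ≤ 2 * k) hxy
      push_cast at A
      have B : returnProb j * (j / 2) ≤ returnProb j * (j - 8 * (2 * (k : ℝ)) ^ 2) :=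
        mul_le_mul_of_nonneg_left (by nlinarith) (returnProb_nonneg j)
      have C : returnProb j / 2 ≤ pairKernel j (x - y) := by
        refine le_of_mul_le_mul_right ?_ hj0
        linarith
      have D := le_returnProb j
      have E : Real.log (j + 2) - Real.log (j + 1) ≤ 1 / (j + 1) := by
        rw [← Real.log_div (by positivity) (by positivity)]
        refine (Real.log_le_sub_one_of_pos (by positivity)).trans (le_of_eq ?_)
        field_simp
        ring
      rw [one_div, mul_inv] at D
      rw [one_div] at E
      linarith
    have hsum : ∀ m : ℕ, (Real.log (64 * (k : ℝ) ^ 2 + m + 1) - Real.log (64 * (k : ℝ) ^ 2 + 1)) / 8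
        ≤ ∑ j ∈ Finset.range (64 * k ^ 2 + m), pairKernel j (x - y) := by
      intro m
      induction m with
      | zero =>
        simp only [Nat.cast_zero, add_zero, sub_self, zero_div]
        exact Finset.sum_nonneg fun j _ => pairKernel_nonneg _ _
      | succ m ih =>
        rw [← add_assoc, Finset.sum_range_succ]
        have := hterm (64 * k ^ 2 + m) (by omega)
        push_cast at this ⊢
        rw [show 64 * (k : ℝ) ^ 2 + (m + 1) + 1 = 64 * (k : ℝ) ^ 2 + m + 2 by ring]
        linarith
    obtain ⟨m, hm⟩ := Nat.exists_eq_add_of_le hJ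
    have hm' : (J : ℝ) + 1 = 64 * (k : ℝ) ^ 2 + m := by exact_mod_cast hm
    rw [green_eq_sum_pairKernel, hm, hℓ, show (J : ℝ) + 2 = 64 * (k : ℝ) ^ 2 + m + 1 by linarith]
    exact hsum m
  have h1 : ∑ _y ∈ box z k, ℓ / 8 ≤ occTime (box z k) (2 * J + 1) x := Finset.sum_le_sum hg
  rw [Finset.sum_const, card_box, nsmul_eq_mul] at h1
  refine le_trans ?_ h1
  push_cast
  nlinarith [mul_nonneg hℓ0 (by linarith : (0 : ℝ) ≤ k)]

/-- The probability that the walk started at `x` visits `Q` up to time `t`, but between its first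
visit to `Q` and time `t` does not visit all points of `U`. -/
noncomputable def hitMissProb (Q U : Finset (Fin 2 → ℤ)) : ℕ → (Fin 2 → ℤ) → ℝ
  | 0, x => if x ∈ Q then uncoverProb 0 x U else 0
  | t + 1, x => if x ∈ Q then uncoverProb (t + 1) x U else nbrAvg (hitMissProb Q U t) x

lemma hitMissProb_of_mem {Q U : Finset (Fin 2 → ℤ)} {x : Fin 2 → ℤ} (hx : x ∈ Q) (t : ℕ) :
    hitMissProb Q U t x = uncoverProb t x U := by
  cases t <;> simp [hitMissProb, hx]

lemma hitMissProb_le_occTime (Q U : Finset (Fin 2 → ℤ)) (t : ℕ) (x : Fin 2 → ℤ) :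
    hitMissProb Q U t x ≤ occTime Q t x := by
  induction t generalizing x with
  | zero =>
    rw [occTime_zero, hitMissProb]
    split_ifs
    · exact uncoverProb_le_one _ _ _
    · exact le_rfl
  | succ t ih =>
    rw [occTime_succ, hitMissProb]
    split_ifs
    · have h1 := uncoverProb_le_one (t + 1) x U
      have h2 : nbrAvg (fun _ => 0) x ≤ nbrAvg (occTime Q t) x :=
        nbrAvg_mono fun a => occTime_nonneg _ _ _
      rw [nbrAvg_const] at h2
      linarith
    · rw [zero_add]
      exact nbrAvg_mono fun a => ih _

/-- A first visit to `Q` either leaves more than `m` units of time, or counts towards the time spent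
in `Q` during the last `m + 1` units of time. -/
lemma hitMissProb_le {Q U : Finset (Fin 2 → ℤ)} {m : ℕ} {δ : ℝ} (hδ : 0 ≤ δ)
    (h : ∀ t, m ≤ t → ∀ x ∈ Q, uncoverProb t x U ≤ δ) (d : ℕ) (x : Fin 2 → ℤ) :
    hitMissProb Q U (m + d) x ≤ δ * hitProb Q (m + d) x + nbrAvg^[d] (occTime Q m) x := by
  induction d generalizing x with
  | zero =>
    have h1 := hitMissProb_le_occTime Q U m x
    have h2 := mul_nonneg hδ (hitProb_nonneg Q m x)
    simp only [add_zero, Function.iterate_zero, id]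
    linarith
  | succ d ih =>
    have hnn : ∀ d y, 0 ≤ nbrAvg^[d] (occTime Q m) y := by
      intro d
      induction d with
      | zero => intro y; exact occTime_nonneg _ _ _
      | succ d ih =>
        intro y
        rw [Function.iterate_succ_apply', ← nbrAvg_const 0 y]
        exact nbrAvg_mono fun a => ih _
    by_cases hx : x ∈ Q
    · rw [hitMissProb_of_mem hx]
      have h1 := h (m + (d + 1)) (by omega) x hx
      have h2 := hnn (d + 1) x
      have h3 : hitProb Q (m + (d + 1)) x = 1 := by
        rw [← add_assoc, hitProb, if_pos hx]
      rw [h3]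
      linarith
    · rw [← add_assoc, hitMissProb, if_neg hx, hitProb, if_neg hx, Function.iterate_succ_apply',
        ← nbrAvg_const_mul, ← nbrAvg_add]
      exact nbrAvg_mono fun a => ih _

lemma sum_iterate_occTime_le {ι : Type*} {s : Finset ι} {Q : ι → Finset (Fin 2 → ℤ)}
    (hQ : ∀ x, ∑ z ∈ s, (if x ∈ Q z then (1 : ℝ) else 0) ≤ 1) (m d : ℕ) (x : Fin 2 → ℤ) :
    ∑ z ∈ s, nbrAvg^[d] (occTime (Q z) m) x ≤ m + 1 := by
  induction d generalizing x with
  | zero => exact sum_occTime_le hQ m x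
  | succ d ih =>
    simp only [Function.iterate_succ_apply']
    rw [← nbrAvg_sum, ← nbrAvg_const ((m : ℝ) + 1) x]
    exact nbrAvg_mono fun a => ih _

/-! ### First-step decomposition of the path measure -/

lemma exW_mono {d n : ℕ} {f g : (Fin n → Fin d × Bool) → ℝ} (h : ∀ ω, f ω ≤ g ω) :
    exW d n f ≤ exW d n g :=
  div_le_div_of_nonneg_right (Finset.sum_le_sum fun ω _ => h ω) (by positivity)

lemma exW_sum {d n : ℕ} {ι : Type*} (s : Finset ι) (f : ι → (Fin n → Fin d × Bool) → ℝ) :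
    exW d n (fun ω => ∑ i ∈ s, f i ω) = ∑ i ∈ s, exW d n (f i) := by
  simp only [exW]
  rw [Finset.sum_comm, Finset.sum_div]

lemma exW_zero {d : ℕ} (f : (Fin 0 → Fin d × Bool) → ℝ) : exW d 0 f = f Fin.elim0 := by
  simp only [exW, pow_zero, div_one, Fintype.sum_unique]
  congr 1

lemma exW_succ {n : ℕ} (f : (Fin (n + 1) → Fin 2 × Bool) → ℝ) :
    exW 2 (n + 1) f = (∑ a : Fin 2 × Bool, exW 2 n fun ω => f (Fin.cons a ω)) / 4 := by
  have h : ∑ ω, f ω = ∑ a : Fin 2 × Bool, ∑ ω : Fin n → Fin 2 × Bool, f (Fin.cons a ω) := by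
    rw [← Fintype.sum_prod_type' fun (a : Fin 2 × Bool) (ω : Fin n → Fin 2 × Bool) =>
      f (Fin.cons a ω)]
    exact (Fintype.sum_equiv (Fin.consEquiv fun _ => Fin 2 × Bool) _ _ fun _ => rfl).symm
  simp only [exW]
  rw [h, ← Finset.sum_div, div_div, pow_succ]
  norm_num

lemma walk_zero_steps {d n : ℕ} (z : Fin d → ℤ) (ω : Fin n → Fin d × Bool) : walk z ω 0 = z := by
  simp [walk]

lemma walk_cons {d n : ℕ} (z : Fin d → ℤ) (a : Fin d × Bool) (ω : Fin n → Fin d × Bool) (k : ℕ) :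
    walk z (Fin.cons a ω : Fin (n + 1) → Fin d × Bool) (k + 1) = walk (z + step a) ω k := by
  simp only [walk, Finset.sum_filter, Fin.sum_univ_succ]
  simp [add_assoc]

lemma rangeW_zero {d : ℕ} (z : Fin d → ℤ) (ω : Fin 0 → Fin d × Bool) : rangeW z ω = {z} := by
  simp [rangeW, walk_zero_steps]

lemma rangeW_cons {d n : ℕ} (z : Fin d → ℤ) (a : Fin d × Bool) (ω : Fin n → Fin d × Bool) :
    rangeW z (Fin.cons a ω : Fin (n + 1) → Fin d × Bool) = insert z (rangeW (z + step a) ω) := by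
  ext x
  simp only [rangeW, Finset.mem_image, Finset.mem_range, Finset.mem_insert]
  constructor
  · rintro ⟨k, hk, rfl⟩
    cases k with
    | zero => left; exact walk_zero_steps _ _
    | succ k => right; exact ⟨k, by omega, (walk_cons _ _ _ _).symm⟩
  · rintro (rfl | ⟨k, hk, rfl⟩)
    · exact ⟨0, by omega, walk_zero_steps _ _⟩
    · exact ⟨k + 1, by omega, walk_cons _ _ _ _⟩

lemma exW_not_subset_rangeW (n : ℕ) (x : Fin 2 → ℤ) (U : Finset (Fin 2 → ℤ)) :
    exW 2 n (fun ω => if U ⊆ rangeW x ω then 0 else 1) = uncoverProb n x U := by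
  induction n generalizing x U with
  | zero =>
    rw [exW_zero, rangeW_zero, uncoverProb]
    simp only [Finset.erase_eq_empty_iff, Finset.subset_singleton_iff]
  | succ n ih =>
    simp only [exW_succ, rangeW_cons, Finset.subset_insert_iff, ih, uncoverProb, nbrAvg]

lemma exW_hit_miss_le (n : ℕ) (x : Fin 2 → ℤ) (Q U : Finset (Fin 2 → ℤ)) :
    exW 2 n (fun ω => if (rangeW x ω ∩ Q).Nonempty ∧ ¬ U ⊆ rangeW x ω then 1 else 0) ≤
      hitMissProb Q U n x := by
  induction n generalizing x with
  | zero =>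
    by_cases hx : x ∈ Q
    · rw [hitMissProb_of_mem hx, ← exW_not_subset_rangeW]
      refine exW_mono fun ω => ?_
      split_ifs <;> simp_all
    · rw [exW_zero, rangeW_zero, hitMissProb, if_neg hx, if_neg]
      simp [hx]
  | succ n ih =>
    by_cases hx : x ∈ Q
    · rw [hitMissProb_of_mem hx, ← exW_not_subset_rangeW]
      refine exW_mono fun ω => ?_
      split_ifs <;> simp_all
    · rw [hitMissProb, if_neg hx, exW_succ, nbrAvg]
      refine div_le_div_of_nonneg_right (Finset.sum_le_sum fun a _ => ?_) (by norm_num)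
      refine le_trans (exW_mono fun ω => ?_) (ih (x + step a))
      rw [rangeW_cons, Finset.insert_inter_of_notMem hx]
      have : U ⊆ rangeW (x + step a) ω → U ⊆ insert x (rangeW (x + step a) ω) :=
        fun h => h.trans (Finset.subset_insert _ _)
      split_ifs with p q
      · norm_num
      · exact absurd ⟨p.1, fun h => p.2 (this h)⟩ q
      · norm_num
      · norm_num

/-! ### Counting squares -/

lemma eq_of_mem_box_of_mem_lat {k : ℕ} {x z z' : Fin 2 → ℤ} (hz : z ∈ lat k) (hz' : z' ∈ lat k)
    (h : x ∈ box z k) (h' : x ∈ box z' k) : z = z' := by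
  obtain ⟨w, rfl⟩ := hz
  obtain ⟨w', rfl⟩ := hz'
  congr 1
  funext i
  have h1 := abs_le.1 (mem_box.1 h i)
  have h2 := abs_le.1 (mem_box.1 h' i)
  simp only [Pi.smul_apply, smul_eq_mul] at h1 h2
  by_contra hne
  rcases lt_or_gt_of_ne hne with hlt | hlt
  · have : (2 * (k : ℤ) + 1) * 1 ≤ (2 * (k : ℤ) + 1) * (w' i - w i) :=
      mul_le_mul_of_nonneg_left (by omega) (by positivity)
    linarith
  · have : (2 * (k : ℤ) + 1) * 1 ≤ (2 * (k : ℤ) + 1) * (w i - w' i) :=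
      mul_le_mul_of_nonneg_left (by omega) (by positivity)
    linarith

lemma sum_indicator_box_le_one {k : ℕ} {s : Finset (Fin 2 → ℤ)} (hs : ∀ z ∈ s, z ∈ lat k)
    (x : Fin 2 → ℤ) : ∑ z ∈ s, (if x ∈ box z k then (1 : ℝ) else 0) ≤ 1 := by
  rw [Finset.sum_boole]
  have : (s.filter fun z => x ∈ box z k).card ≤ 1 := by
    refine Finset.card_le_one.2 fun z hz z' hz' => ?_
    rw [Finset.mem_filter] at hz hz'
    exact eq_of_mem_box_of_mem_lat (hs z hz.1) (hs z' hz'.1) hz.2 hz'.2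
  exact_mod_cast this

lemma mem_square_add_step {x z : Fin 2 → ℤ} {k : ℕ} (hx : x ∈ square z k) (a : Fin 2 × Bool) :
    x + step a ∈ box z (k + 1) := by
  refine mem_box.2 fun i => ?_
  have h1 := hx i
  have h2 := abs_step_le a i
  have h3 := abs_add_le (x i - z i) (step a i)
  have h4 : (x + step a) i - z i = x i - z i + step a i := by simp only [Pi.add_apply]; ring
  rw [h4]
  push_cast
  linarith

/-- The expected number of squares meeting the boundary of the range is at most the sum, over a
finite family of lattice squares, of the probability of visiting the square and then failing to
cover its neighbourhood. -/
lemma exW_Mnum_le (k n : ℕ) : ∃ s : Finset (Fin 2 → ℤ), (∀ z ∈ s, z ∈ lat k) ∧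
    exW 2 n (fun ω => (Mnum k n ω : ℝ)) ≤ ∑ z ∈ s, hitMissProb (box z k) (box z (k + 1)) n 0 := by
  set A : (Fin n → Fin 2 × Bool) → Set (Fin 2 → ℤ) := fun ω =>
    {z | z ∈ lat k ∧ ∃ x ∈ innerBdry (rangeW (0 : Fin 2 → ℤ) ω), x ∈ square z k} with hA
  have hfin : ∀ ω, (A ω).Finite := by
    intro ω
    refine Set.Finite.subset
      ((innerBdry (rangeW (0 : Fin 2 → ℤ) ω)).biUnion fun x => box x k).finite_toSet ?_
    rintro z ⟨-, x, hx, hxz⟩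
    simp only [Finset.coe_biUnion, Set.mem_iUnion, Finset.mem_coe]
    exact ⟨x, hx, mem_box.2 fun i => by rw [abs_sub_comm]; exact hxz i⟩
  have hU := Set.finite_iUnion hfin
  refine ⟨hU.toFinset, ?_, ?_⟩
  · intro z hz
    obtain ⟨ω, hω⟩ := Set.mem_iUnion.1 (hU.mem_toFinset.1 hz)
    exact hω.1
  · refine le_trans ?_ (Finset.sum_le_sum fun z _ => exW_hit_miss_le n 0 (box z k) (box z (k + 1)))
    rw [← exW_sum]
    refine exW_mono fun ω => ?_
    rw [Finset.sum_boole]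
    have hsub : A ω ⊆ ↑(hU.toFinset.filter fun z => (rangeW 0 ω ∩ box z k).Nonempty ∧
        ¬ box z (k + 1) ⊆ rangeW 0 ω) := by
      intro z hz
      obtain ⟨-, x, hx, hxz⟩ := id hz
      obtain ⟨hxr, a, ha⟩ := Finset.mem_filter.1 hx
      simp only [Finset.coe_filter, Set.mem_ofPred_eq, Set.Finite.mem_toFinset]
      refine ⟨Set.mem_iUnion.2 ⟨ω, hz⟩, ⟨x, Finset.mem_inter.2 ⟨hxr, mem_box.2 hxz⟩⟩, fun h => ?_⟩
      exact ha (h (mem_square_add_step hxz a))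
    have := Set.ncard_le_ncard hsub (Finset.finite_toSet _)
    rw [Set.ncard_coe_finset] at this
    exact_mod_cast this

lemma exW_Mnum_le_linear {k n : ℕ} (hk : 2 ≤ k) :
    exW 2 n (fun ω => (Mnum k n ω : ℝ)) ≤ 1605 + 4 * (n / (k : ℝ) ^ 2) := by
  obtain ⟨s, hs, hle⟩ := exW_Mnum_le k n
  refine hle.trans ?_
  have hdisj := sum_indicator_box_le_one hs
  have hk2 : (2 : ℝ) ≤ k := by exact_mod_cast hk
  have hlog2 : 0.69 < Real.log 2 := by linarith [Real.log_two_gt_d9]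
  have hmiss : ∑ z ∈ s, hitMissProb (box z k) (box z (k + 1)) n 0 ≤
      ∑ z ∈ s, hitProb (box z k) n 0 + 1 := by
    have h1 := sum_iterate_occTime_le hdisj 0 n 0
    have h2 : ∑ z ∈ s, hitMissProb (box z k) (box z (k + 1)) n 0 ≤
        ∑ z ∈ s, (1 * hitProb (box z k) n 0 + nbrAvg^[n] (occTime (box z k) 0) 0) :=
      Finset.sum_le_sum fun z _ => by
        have := hitMissProb_le (Q := box z k) (U := box z (k + 1)) (m := 0) zero_le_one
          (fun t _ x _ => uncoverProb_le_one t x _) n 0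
        rwa [zero_add] at this
    simp only [one_mul, Finset.sum_add_distrib] at h2
    push_cast at h1
    linarith
  have hhit := sum_hitProb_le hdisj (T := 2 * (200 * k ^ 2) + 1) (g := (k : ℝ) ^ 2 / 4)
    (fun z _ x hx => by
      refine le_trans ?_ (le_occTime_box (by omega : 1 ≤ k) (by omega) hx)
      have : Real.log 2 ≤ Real.log (((200 * k ^ 2 : ℕ) : ℝ) + 2) - Real.log (64 * (k : ℝ) ^ 2 + 1) := by
        rw [← Real.log_div (by positivity) (by positivity)]
        refine Real.log_le_log (by norm_num) ?_
        rw [le_div_iff₀ (by positivity)]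
        push_cast
        nlinarith
      nlinarith [sq_nonneg (k : ℝ)]) n 0
  have hkk : (4 : ℝ) ≤ (k : ℝ) ^ 2 := by nlinarith
  have : ∑ z ∈ s, hitProb (box z k) n 0 ≤ 1604 + 4 * (n / (k : ℝ) ^ 2) := by
    refine le_of_mul_le_mul_left ?_ (by positivity : 0 < (k : ℝ) ^ 2 / 4)
    refine hhit.trans ?_
    have e : (k : ℝ) ^ 2 / 4 * (1604 + 4 * (n / (k : ℝ) ^ 2)) = 401 * (k : ℝ) ^ 2 + n := by
      field_simp
      ring
    rw [e]
    push_cast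
    linarith
  linarith

lemma sq_le_mul_log_ratio {k n s : ℝ} (hk : 2 ≤ k) (hks : k ^ 2 ≤ s) (hsn : s ^ 4 ≤ n)
    (hln : Real.log n ≤ 8 * Real.log s) :
    s ^ 2 ≤ 600 * ((n / k ^ 2) * (Real.log k) ^ 2 / (Real.log n) ^ 2) := by
  have hs4 : 4 ≤ s := by nlinarith
  have hn1 : 1 < n := lt_of_lt_of_le (one_lt_pow₀ (by linarith) (by norm_num)) hsn
  have hlog2 : 0.69 < Real.log 2 := by linarith [Real.log_two_gt_d9]
  have hlk : Real.log 2 ≤ Real.log k := Real.log_le_log (by norm_num) hk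
  have hls0 : 0 < Real.log s := Real.log_pos (by linarith)
  have hln0 : 0 < Real.log n := Real.log_pos hn1
  have hsq : Real.log s ≤ 2 * √s := by
    have h1 := Real.log_sqrt (by linarith : (0 : ℝ) ≤ s)
    have h2 := Real.log_le_sub_one_of_pos (Real.sqrt_pos.2 (by linarith : (0 : ℝ) < s))
    linarith
  have hsq2 : (Real.log s) ^ 2 ≤ 4 * s := by
    have := pow_le_pow_left₀ hls0.le hsq 2
    rw [mul_pow, Real.sq_sqrt (by linarith)] at this
    linarith
  have hln2 : (Real.log n) ^ 2 ≤ 256 * s := by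
    have := pow_le_pow_left₀ hln0.le hln 2
    rw [mul_pow] at this
    linarith
  have hden : k ^ 2 * (Real.log n) ^ 2 ≤ s * (256 * s) :=
    mul_le_mul hks hln2 (sq_nonneg _) (by linarith)
  have hlk2 : 0.47 ≤ (Real.log k) ^ 2 := by nlinarith
  have e : 600 * (n / k ^ 2 * (Real.log k) ^ 2 / (Real.log n) ^ 2) = 600 * (n * (Real.log k) ^ 2) / (k ^ 2 * (Real.log n) ^ 2) := by
    field_simp
  rw [e, le_div_iff₀ (by positivity)]
  have h1 : s ^ 2 * (k ^ 2 * (Real.log n) ^ 2) ≤ s ^ 2 * (s * (256 * s)) :=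
    mul_le_mul_of_nonneg_left hden (sq_nonneg _)
  have h2 : s ^ 4 * 0.47 ≤ n * (Real.log k) ^ 2 :=
    mul_le_mul hsn hlk2 (by norm_num) (by linarith)
  have h3 : (0 : ℝ) ≤ s ^ 4 := by positivity
  nlinarith

lemma exW_Mnum_le_of_pow_le {k n s : ℕ} (hk : 2 ≤ k) (hks : k ^ 256 ≤ s) (hsn : s ^ 4 ≤ n)
    (hns : n < (s + 1) ^ 4) :
    exW 2 n (fun ω => (Mnum k n ω : ℝ)) ≤
      21630000 * (((n : ℝ) / (k : ℝ) ^ 2) * (Real.log k) ^ 2 / (Real.log n) ^ 2) := by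
  have hk9 : k ^ 9 ≤ s := (Nat.pow_le_pow_right (by omega) (by norm_num)).trans hks
  have hk0 : (2 : ℝ) ≤ k := by exact_mod_cast hk
  have hkk : (4 : ℝ) ≤ (k : ℝ) ^ 2 := by nlinarith
  have hk7 : (128 : ℝ) ≤ (k : ℝ) ^ 7 := by
    have : 2 ^ 7 ≤ k ^ 7 := Nat.pow_le_pow_left hk 7
    exact_mod_cast this
  have hk9r : (k : ℝ) ^ 2 * (k : ℝ) ^ 7 ≤ s := by
    rw [← pow_add]; exact_mod_cast hk9
  have hk2s : 64 * (k : ℝ) ^ 2 + 1 ≤ s := by nlinarith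
  have hs2 : (2 : ℝ) ≤ s := by linarith
  have hsn' : (s : ℝ) ^ 4 ≤ n := by exact_mod_cast hsn
  have hn1 : (1 : ℝ) < n := lt_of_lt_of_le (by nlinarith [sq_nonneg ((s : ℝ) ^ 2 - 1)]) hsn'
  have hlog2 : 0.69 < Real.log 2 := by linarith [Real.log_two_gt_d9]
  have hlk : Real.log 2 ≤ Real.log k := Real.log_le_log (by norm_num) hk0
  have hlk0 : 0 < Real.log k := by linarith
  have hls : Real.log 2 ≤ Real.log s := Real.log_le_log (by norm_num) hs2
  have hls0 : 0 < Real.log s := by linarith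
  have hln0 : 0 < Real.log n := Real.log_pos hn1
  have hln4 : 4 * Real.log s ≤ Real.log n := by
    have := Real.log_le_log (by positivity) hsn'
    rw [Real.log_pow] at this
    exact_mod_cast this
  have hln8 : Real.log n ≤ 8 * Real.log s := by
    have h1 : (n : ℝ) ≤ (s : ℝ) ^ 8 := by
      have h2 : s + 1 ≤ s ^ 2 := by
        have : 2 ≤ s := by exact_mod_cast hs2
        nlinarith
      have h3 : n ≤ s ^ 8 := by
        calc n ≤ (s + 1) ^ 4 := hns.le
          _ ≤ (s ^ 2) ^ 4 := Nat.pow_le_pow_left h2 4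
          _ = s ^ 8 := by ring
      exact_mod_cast h3
    have := Real.log_le_log (by linarith) h1
    rw [Real.log_pow] at this
    exact_mod_cast this
  obtain ⟨B, hB, hle⟩ := exW_Mnum_le k n
  refine hle.trans ?_
  have hdisj := sum_indicator_box_le_one hB
  set δ : ℝ := 245760 * ((Real.log k) ^ 2 / Real.log s) with hδ
  have hs1 : 0 < s := by
    have : (0 : ℝ) < s := by linarith
    exact_mod_cast this
  obtain ⟨d, hN⟩ : ∃ d, n = s ^ 2 + d := Nat.exists_eq_add_of_le
    ((Nat.pow_le_pow_right hs1 (by norm_num)).trans hsn)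
  have hmiss : ∑ z ∈ B, hitMissProb (box z k) (box z (k + 1)) n 0 ≤
      δ * ∑ z ∈ B, hitProb (box z k) n 0 + ((s : ℝ) ^ 2 + 1) := by
    have h1 := sum_iterate_occTime_le hdisj (s ^ 2) d 0
    have h2 : ∑ z ∈ B, hitMissProb (box z k) (box z (k + 1)) n 0 ≤
        ∑ z ∈ B, (δ * hitProb (box z k) n 0 + nbrAvg^[d] (occTime (box z k) (s ^ 2)) 0) :=
      Finset.sum_le_sum fun z _ => by
        have := hitMissProb_le (δ := δ) (by positivity)
          (fun t ht x hx => uncoverProb_box_le (o := z) hk hks ht hx) d 0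
        rwa [← hN] at this
    rw [Finset.sum_add_distrib, ← Finset.mul_sum] at h2
    push_cast at h1
    linarith
  have hhit := sum_hitProb_le hdisj (T := 2 * n + 1) (g := (k : ℝ) ^ 2 * (3 / 8) * Real.log n)
    (fun z _ x hx => by
      have hJ : 64 * k ^ 2 ≤ n + 1 := by
        have h1 : 64 * k ^ 2 + 1 ≤ s := by exact_mod_cast hk2s
        have h2 : s ≤ s ^ 4 := Nat.le_self_pow (by norm_num) s
        omega
      refine le_trans ?_ (le_occTime_box (by omega : 1 ≤ k) hJ hx)
      have h1 : Real.log n ≤ Real.log (n + 2) := Real.log_le_log (by linarith) (by linarith)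
      have h2 : Real.log (64 * (k : ℝ) ^ 2 + 1) ≤ Real.log s :=
        Real.log_le_log (by positivity) hk2s
      have h3 : 3 / 4 * Real.log n ≤ Real.log (n + 2) - Real.log (64 * (k : ℝ) ^ 2 + 1) := by
        linarith
      nlinarith [mul_le_mul_of_nonneg_left h3 (sq_nonneg (k : ℝ))]) n 0
  have hsum : ∑ z ∈ B, hitProb (box z k) n 0 ≤ 11 * (n / ((k : ℝ) ^ 2 * Real.log n)) := by
    refine le_of_mul_le_mul_left ?_ (by positivity : 0 < (k : ℝ) ^ 2 * (3 / 8) * Real.log n)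
    refine hhit.trans ?_
    have e : (k : ℝ) ^ 2 * (3 / 8) * Real.log n * (11 * (n / ((k : ℝ) ^ 2 * Real.log n))) =
        33 / 8 * n := by
      field_simp
      ring
    rw [e]
    push_cast
    have : (16 : ℝ) ≤ n := by
      have : (2 : ℝ) ^ 4 ≤ (s : ℝ) ^ 4 := pow_le_pow_left₀ (by norm_num) hs2 4
      linarith
    linarith
  set X : ℝ := ((n : ℝ) / (k : ℝ) ^ 2) * (Real.log k) ^ 2 / (Real.log n) ^ 2 with hX
  have hδ8 : δ ≤ 1966080 * ((Real.log k) ^ 2 / Real.log n) := by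
    have : (Real.log k) ^ 2 / Real.log s ≤ 8 * ((Real.log k) ^ 2 / Real.log n) := by
      rw [← mul_div_assoc, div_le_div_iff₀ hls0 hln0]
      nlinarith [sq_nonneg (Real.log k)]
    rw [hδ]
    linarith
  have hmain : δ * ∑ z ∈ B, hitProb (box z k) n 0 ≤ 21626880 * X := by
    have h1 := mul_le_mul hδ8 hsum (Finset.sum_nonneg fun z _ => hitProb_nonneg _ _ _)
      (by positivity)
    refine h1.trans (le_of_eq ?_)
    rw [hX]
    field_simp
    norm_num
  have hlate : (s : ℝ) ^ 2 ≤ 600 * X :=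
    sq_le_mul_log_ratio hk0 (by linarith) hsn' hln8
  have : (1 : ℝ) ≤ (s : ℝ) ^ 2 := one_le_pow₀ (by linarith)
  linarith

lemma linear_le_of_lt_pow {k n s : ℕ} (hk : 2 ≤ k) (hn : 2 ≤ n) (hsk : s < k ^ 256)
    (hns : n < (s + 1) ^ 4) :
    (n : ℝ) / (k : ℝ) ^ 2 ≤
      1024 ^ 2 * (((n : ℝ) / (k : ℝ) ^ 2) * (Real.log k) ^ 2 / (Real.log n) ^ 2) := by
  have hnk : n ≤ k ^ 1024 := by
    calc n ≤ (s + 1) ^ 4 := hns.le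
      _ ≤ (k ^ 256) ^ 4 := Nat.pow_le_pow_left hsk 4
      _ = k ^ 1024 := by rw [← pow_mul]
  have hn0 : (2 : ℝ) ≤ n := by exact_mod_cast hn
  have hln0 : 0 < Real.log n := Real.log_pos (by linarith)
  have hln : Real.log n ≤ 1024 * Real.log k := by
    have := Real.log_le_log (by linarith) (by exact_mod_cast hnk : (n : ℝ) ≤ (k : ℝ) ^ 1024)
    rw [Real.log_pow] at this
    exact_mod_cast this
  have h2 := pow_le_pow_left₀ hln0.le hln 2
  rw [mul_pow] at h2
  rw [← mul_div_assoc, le_div_iff₀ (by positivity)]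
  have := mul_le_mul_of_nonneg_left h2 (by positivity : (0 : ℝ) ≤ (n : ℝ) / (k : ℝ) ^ 2)
  linarith

end BoundarySquares

/-- `E[M(k,n)] ≤ C · max{1, (n/k²) · (log k)²/(log n)²}`, where `M(k,n)` is the number of
squares of the `(2k+1)`-tiling of `ℤ²` that meet the inner boundary of the range. -/
theorem expected_boundary_squares :
    ∃ C : ℝ, 0 < C ∧ ∀ k n : ℕ, 2 ≤ k → 2 ≤ n →
      exW 2 n (fun ω => (Mnum k n ω : ℝ)) ≤
        C * max 1 (((n : ℝ) / (k : ℝ) ^ 2) * (Real.log k) ^ 2 / (Real.log n) ^ 2) := by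
  refine ⟨100000000, by norm_num, fun k n hk hn => ?_⟩
  obtain ⟨s, hsn, hns⟩ : ∃ s : ℕ, s ^ 4 ≤ n ∧ n < (s + 1) ^ 4 := by
    refine ⟨n.sqrt.sqrt, ?_, ?_⟩
    · calc n.sqrt.sqrt ^ 4 = (n.sqrt.sqrt ^ 2) ^ 2 := by ring
        _ ≤ n.sqrt ^ 2 := Nat.pow_le_pow_left (Nat.sqrt_le' _) 2
        _ ≤ n := Nat.sqrt_le' _
    · calc n < (n.sqrt + 1) ^ 2 := Nat.lt_succ_sqrt' _
        _ ≤ ((n.sqrt.sqrt + 1) ^ 2) ^ 2 := Nat.pow_le_pow_left (Nat.lt_succ_sqrt' _) 2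
        _ = (n.sqrt.sqrt + 1) ^ 4 := by ring
  have h1 := le_max_left 1 (((n : ℝ) / (k : ℝ) ^ 2) * (Real.log k) ^ 2 / (Real.log n) ^ 2)
  have h2 := le_max_right 1 (((n : ℝ) / (k : ℝ) ^ 2) * (Real.log k) ^ 2 / (Real.log n) ^ 2)
  rcases le_or_gt (k ^ 256) s with hks | hsk
  · have := BoundarySquares.exW_Mnum_le_of_pow_le hk hks hsn hns
    linarith
  · have h3 := BoundarySquares.exW_Mnum_le_linear (n := n) hk
    have h4 := BoundarySquares.linear_le_of_lt_pow hk hn hsk hns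
    linarith
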